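/- arXiv:1511.00261 — 6 statements merged into one kernel-verified Lean document; each statement's English description precedes it below -/
import Mathlib

section
/- Let G be a finitely generated group, let φ : G → G be a group automorphism, and let H be a subgroup of G of finite index. Then there exists an integer n ≥ 1 such that the image of H under the n-fold composition φ^n equals H. -/
/-- There are only finitely many homomorphisms from a finitely generated group to a
finite group. -/
theorem MonoidHom.finite_of_group_fg (G K : Type*) [Group G] [Group.FG G] [Group K] [Finite K] :
    Finite (G →* K) := by
  obtain ⟨S, hS⟩ := Group.FG.out (G := G)
  refine Finite.of_injective (fun (f : G →* K) (s : S) => f s) fun f g hfg => ?_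
  exact MonoidHom.eq_of_eqOn_dense hS fun s hs => congrFun hfg ⟨s, hs⟩

/-- M. Hall's theorem: a finitely generated group has only finitely many subgroups of a given
finite index. -/
theorem Subgroup.finite_setOf_index_eq (G : Type*) [Group G] [Group.FG G] {n : ℕ} (hn : n ≠ 0) :
    {H : Subgroup G | H.index = n}.Finite := by
  have := MonoidHom.finite_of_group_fg G (Equiv.Perm (Fin n))
  refine (Set.finite_range fun p : (G →* Equiv.Perm (Fin n)) × Fin n =>
    (MulAction.stabilizer (Equiv.Perm (Fin n)) p.2).comap p.1).subset ?_
  intro H hH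
  have : H.FiniteIndex := ⟨fun h => hn (hH.symm.trans h)⟩
  let e : G ⧸ H ≃ Fin n := Finite.equivFinOfCardEq hH
  refine ⟨(e.permCongrHom.toMonoidHom.comp (MulAction.toPermHom G (G ⧸ H)), e (1 : G)), ?_⟩
  ext g
  simp [MulAction.mem_stabilizer_iff, Equiv.permCongrHom, Equiv.permCongr_apply, QuotientGroup.eq]

/-- If `G` is a finitely generated group, `φ : G → G` is an automorphism, and `H ≤ G` has
finite index, then some positive iterate `φ^n` maps `H` onto `H`. -/
theorem stmt_0 (G : Type*) [Group G] [Group.FG G] (φ : MulAut G)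
    (H : Subgroup G) (hH : H.FiniteIndex) :
    ∃ n : ℕ, 1 ≤ n ∧ H.map ((φ ^ n : MulAut G) : G →* G) = H := by
  open scoped Pointwise in
  obtain ⟨a, b, hab, h⟩ := (Subgroup.finite_setOf_index_eq G hH.index_ne_zero
    ).exists_lt_map_eq_of_forall_mem (f := fun k : ℕ => φ ^ k • H)
      fun k => H.index_map_equiv (φ ^ k)
  obtain ⟨c, rfl⟩ := Nat.exists_eq_add_of_lt hab
  refine ⟨c + 1, by omega, ?_⟩
  simp only [add_assoc, pow_add φ a, mul_smul] at h
  exact (MulAction.injective (φ ^ a) h).symm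
end

section
/- Let Γ be a group in which the intersection of all maximal nilpotent subgroups is the trivial subgroup, and let G be a nilpotent group. Then the intersection of all maximal nilpotent subgroups of the direct product Γ × G is exactly the subgroup {1} × G. -/
/-- A subgroup is maximal nilpotent if it is nilpotent and maximal (w.r.t. inclusion)
among nilpotent subgroups. -/
def IsMaximalNilpotentSubgroup {G : Type*} [Group G] (H : Subgroup G) : Prop :=
  Group.IsNilpotent H ∧ ∀ K : Subgroup G, Group.IsNilpotent K → H ≤ K → K = H

theorem Subgroup.isNilpotent_prod {A B : Type*} [Group A] [Group B] (H : Subgroup A)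
    (K : Subgroup B) [Group.IsNilpotent H] [Group.IsNilpotent K] :
    Group.IsNilpotent (H.prod K) :=
  Group.nilpotent_of_mulEquiv (H.prodEquiv K).symm

theorem Subgroup.isNilpotent_map {A B : Type*} [Group A] [Group B] (f : A →* B)
    (H : Subgroup A) [Group.IsNilpotent H] : Group.IsNilpotent (H.map f) :=
  Group.nilpotent_of_surjective (f.subgroupMap H) (f.subgroupMap_surjective H)

theorem Subgroup.le_map_fst_prod_top {A B : Type*} [Group A] [Group B]
    (K : Subgroup (A × B)) : K ≤ (K.map (MonoidHom.fst A B)).prod ⊤ :=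
  Subgroup.le_prod_iff.2 ⟨le_rfl, le_top⟩

theorem Subgroup.isNilpotent_prod_top {A B : Type*} [Group A] [Group B] [Group.IsNilpotent B]
    (H : Subgroup A) [Group.IsNilpotent H] : Group.IsNilpotent (H.prod (⊤ : Subgroup B)) :=
  H.isNilpotent_prod ⊤

theorem IsMaximalNilpotentSubgroup.prod_top {A B : Type*} [Group A] [Group B]
    [Group.IsNilpotent B] {H : Subgroup A} (hH : IsMaximalNilpotentSubgroup H) :
    IsMaximalNilpotentSubgroup (H.prod (⊤ : Subgroup B)) := by
  have := hH.1
  refine ⟨H.isNilpotent_prod_top, fun K hK hle => le_antisymm ?_ hle⟩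
  have hmap : K.map (MonoidHom.fst A B) = H :=
    hH.2 _ (K.isNilpotent_map _) fun x hx => ⟨(x, 1), hle ⟨hx, Subgroup.mem_top _⟩, rfl⟩
  exact hmap ▸ K.le_map_fst_prod_top

theorem IsMaximalNilpotentSubgroup.map_fst_prod_top_eq {A B : Type*} [Group A] [Group B]
    [Group.IsNilpotent B] {M : Subgroup (A × B)} (hM : IsMaximalNilpotentSubgroup M) :
    (M.map (MonoidHom.fst A B)).prod ⊤ = M := by
  have := hM.1
  have := M.isNilpotent_map (MonoidHom.fst A B)
  exact hM.2 _ (Subgroup.isNilpotent_prod_top _) M.le_map_fst_prod_top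

/-- If the intersection of all maximal nilpotent subgroups of `Γ` is trivial and `G` is
nilpotent, then the intersection of all maximal nilpotent subgroups of `Γ × G` is `{1} × G`. -/
theorem stmt_2 (Γ G : Type*) [Group Γ] [Group G] [Group.IsNilpotent G]
    (hΓ : sInf {H : Subgroup Γ | IsMaximalNilpotentSubgroup H} = ⊥) :
    sInf {H : Subgroup (Γ × G) | IsMaximalNilpotentSubgroup H}
      = (⊥ : Subgroup Γ).prod (⊤ : Subgroup G) := by
  apply le_antisymm
  · intro x hx
    refine ⟨?_, Subgroup.mem_top _⟩
    change x.1 ∈ (⊥ : Subgroup Γ)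
    rw [← hΓ, Subgroup.mem_sInf]
    intro H hH
    exact (Subgroup.mem_sInf.1 hx _ (IsMaximalNilpotentSubgroup.prod_top hH)).1
  · refine le_sInf fun M hM => ?_
    rw [← IsMaximalNilpotentSubgroup.map_fst_prod_top_eq hM]
    exact Subgroup.prod_mono bot_le le_rfl
end

section
/- Let Γ and G be groups, let α be an inner automorphism of Γ, let L be an automorphism of G, and let ρ, θ : Γ → Z(G) be group homomorphisms into the center of G satisfying L(θ(γ)) = ρ(γ)·θ(γ) for all γ ∈ Γ. Define maps f, h : Γ × G → Γ × G by f(γ, g) = (α(γ), ρ(γ)·L(g)) and h(γ, g) = (γ, θ(γ)·g). Then h is an automorphism of Γ × G, and (h ∘ f ∘ h⁻¹)(γ, g) = (α(γ), L(g)) for all (γ, g) ∈ Γ × G. -/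
/-- The automorphism `(γ, g) ↦ (γ, θ γ * g)` of `Γ × G` given by a homomorphism `θ` with
central values. -/
def centralShear {Γ G : Type*} [Group Γ] [Group G] (θ : Γ →* G)
    (hθ : ∀ γ : Γ, θ γ ∈ Subgroup.center G) : MulAut (Γ × G) where
  toFun p := (p.1, θ p.1 * p.2)
  invFun p := (p.1, (θ p.1)⁻¹ * p.2)
  left_inv p := by simp
  right_inv p := by simp
  map_mul' p q := by
    have hcomm : p.2 * θ q.1 = θ q.1 * p.2 := Subgroup.mem_center_iff.mp (hθ q.1) p.2
    ext
    · rfl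
    · change θ (p.1 * q.1) * (p.2 * q.2) = θ p.1 * p.2 * (θ q.1 * q.2)
      rw [map_mul, mul_assoc, mul_assoc, ← mul_assoc p.2, hcomm, mul_assoc]

/-- The global change of coordinates: if `α` is an inner automorphism of `Γ`, `L ∈ Aut G`,
and `ρ, θ : Γ → Z(G)` are homomorphisms into the center of `G` with
`L(θ(γ)) = ρ(γ)·θ(γ)` for all `γ`, then `h(γ, g) = (γ, θ(γ)·g)` is an automorphism of
`Γ × G` and conjugating `f(γ, g) = (α(γ), ρ(γ)·L(g))` by `h` yields `(γ, g) ↦ (α(γ), L(g))`. -/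
theorem stmt_6 (Γ G : Type*) [Group Γ] [Group G]
    (α : MulAut Γ) (hα : ∃ δ : Γ, ∀ γ : Γ, α γ = δ * γ * δ⁻¹)
    (L : MulAut G) (ρ θ : Γ →* G)
    (hρ : ∀ γ : Γ, ρ γ ∈ Subgroup.center G)
    (hθ : ∀ γ : Γ, θ γ ∈ Subgroup.center G)
    (hLθ : ∀ γ : Γ, L (θ γ) = ρ γ * θ γ) :
    ∃ h : MulAut (Γ × G),
      (∀ (γ : Γ) (g : G), h (γ, g) = (γ, θ γ * g)) ∧
      (∀ (γ : Γ) (g : G),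
        h ((fun p : Γ × G => (α p.1, ρ p.1 * L p.2)) (h.symm (γ, g))) = (α γ, L g)) := by
  obtain ⟨δ, hδ⟩ := hα
  refine ⟨centralShear θ hθ, fun _ _ => rfl, fun γ g => ?_⟩
  have hθα : θ (α γ) = θ γ := by
    rw [hδ, map_mul, map_mul, map_inv, (Subgroup.mem_center_iff.mp (hθ γ) (θ δ)),
      mul_inv_cancel_right]
  have hρθ : ρ γ * θ γ = θ γ * ρ γ := Subgroup.mem_center_iff.mp (hθ γ) (ρ γ)
  change (α γ, θ (α γ) * (ρ γ * L ((θ γ)⁻¹ * g))) = (α γ, L g)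
  rw [hθα, map_mul, map_inv, hLθ, hρθ, ← mul_assoc, ← mul_assoc, mul_inv_cancel, one_mul]
end

section
/- Let G₁ and G₂ be groups. A subgroup M of the direct product G₁ × G₂ is a maximal nilpotent subgroup of G₁ × G₂ if and only if M = M₁ × M₂, where M₁ is a maximal nilpotent subgroup of G₁ and M₂ is a maximal nilpotent subgroup of G₂. -/
theorem Subgroup.isNilpotent_map_s8 {G H : Type*} [Group G] [Group H] (f : G →* H)
    {K : Subgroup G} (hK : Group.IsNilpotent K) : Group.IsNilpotent (K.map f) :=
  Group.nilpotent_of_surjective (f.subgroupMap K) (f.subgroupMap_surjective K)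

theorem Subgroup.isNilpotent_prod_s8 {G H : Type*} [Group G] [Group H] {K : Subgroup G}
    {L : Subgroup H} (hK : Group.IsNilpotent K) (hL : Group.IsNilpotent L) :
    Group.IsNilpotent (K.prod L) :=
  (Group.isNilpotent_congr (K.prodEquiv L)).2 inferInstance

/-- A subgroup `M ≤ G₁ × G₂` is a maximal nilpotent subgroup if and only if it is the
product `M₁ × M₂` of maximal nilpotent subgroups of the factors. -/
theorem stmt_8 (G₁ G₂ : Type*) [Group G₁] [Group G₂] (M : Subgroup (G₁ × G₂)) :
    IsMaximalNilpotentSubgroup M ↔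
      ∃ (M₁ : Subgroup G₁) (M₂ : Subgroup G₂),
        IsMaximalNilpotentSubgroup M₁ ∧ IsMaximalNilpotentSubgroup M₂ ∧ M = M₁.prod M₂ := by
  constructor
  · rintro ⟨hM, hmax⟩
    have h₁ := Subgroup.isNilpotent_map_s8 (MonoidHom.fst G₁ G₂) hM
    have h₂ := Subgroup.isNilpotent_map_s8 (MonoidHom.snd G₁ G₂) hM
    have hle : M ≤ (M.map (MonoidHom.fst G₁ G₂)).prod (M.map (MonoidHom.snd G₁ G₂)) :=
      Subgroup.le_prod_iff.2 ⟨le_rfl, le_rfl⟩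
    refine ⟨_, _, ⟨h₁, fun K hK hPK => le_antisymm (fun x hx => ?_) hPK⟩,
      ⟨h₂, fun K hK hQK => le_antisymm (fun x hx => ?_) hQK⟩,
      (hmax _ (Subgroup.isNilpotent_prod_s8 h₁ h₂) hle).symm⟩
    · have hKM := hmax _ (Subgroup.isNilpotent_prod_s8 hK h₂)
        (hle.trans (Subgroup.prod_mono hPK le_rfl))
      exact ⟨(x, 1), hKM.le (Subgroup.mem_prod.2 ⟨hx, one_mem _⟩), rfl⟩
    · have hKM := hmax _ (Subgroup.isNilpotent_prod_s8 h₁ hK)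
        (hle.trans (Subgroup.prod_mono le_rfl hQK))
      exact ⟨(1, x), hKM.le (Subgroup.mem_prod.2 ⟨one_mem _, hx⟩), rfl⟩
  · rintro ⟨M₁, M₂, ⟨h₁, hmax₁⟩, ⟨h₂, hmax₂⟩, rfl⟩
    refine ⟨Subgroup.isNilpotent_prod_s8 h₁ h₂, fun K hK hle => le_antisymm ?_ hle⟩
    refine Subgroup.le_prod_iff.2 ⟨(hmax₁ _ (Subgroup.isNilpotent_map_s8 _ hK) fun x hx => ?_).le,
      (hmax₂ _ (Subgroup.isNilpotent_map_s8 _ hK) fun x hx => ?_).le⟩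
    · exact ⟨(x, 1), hle (Subgroup.mem_prod.2 ⟨hx, one_mem _⟩), rfl⟩
    · exact ⟨(1, x), hle (Subgroup.mem_prod.2 ⟨one_mem _, hx⟩), rfl⟩
end

section
/- Let G₁ and G₂ be groups such that, for each i ∈ {1, 2}, the intersection of all maximal nilpotent subgroups of G_i is the trivial subgroup. Then the intersection of all maximal nilpotent subgroups of the direct product G₁ × G₂ is the trivial subgroup. -/
theorem IsMaximalNilpotentSubgroup.prod {G₁ G₂ : Type*} [Group G₁] [Group G₂]
    {H₁ : Subgroup G₁} {H₂ : Subgroup G₂} (h₁ : IsMaximalNilpotentSubgroup H₁)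
    (h₂ : IsMaximalNilpotentSubgroup H₂) : IsMaximalNilpotentSubgroup (H₁.prod H₂) := by
  have := h₁.1
  have := h₂.1
  refine ⟨Group.nilpotent_of_mulEquiv (Subgroup.prodEquiv H₁ H₂).symm, fun K hK hle => ?_⟩
  obtain ⟨hle₁, hle₂⟩ := Subgroup.prod_le_iff.1 hle
  have fst_eq : K.map (MonoidHom.fst G₁ G₂) = H₁ :=
    h₁.2 _ (Group.nilpotent_of_surjective _ (MonoidHom.subgroupMap_surjective _ K)) fun x hx =>
      ⟨(x, 1), hle₁ ⟨x, hx, rfl⟩, rfl⟩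
  have snd_eq : K.map (MonoidHom.snd G₁ G₂) = H₂ :=
    h₂.2 _ (Group.nilpotent_of_surjective _ (MonoidHom.subgroupMap_surjective _ K)) fun x hx =>
      ⟨(1, x), hle₂ ⟨x, hx, rfl⟩, rfl⟩
  exact le_antisymm (Subgroup.le_prod_iff.2 ⟨fst_eq.le, snd_eq.le⟩) hle

theorem exists_isMaximalNilpotentSubgroup_of_sInf_eq_bot {G : Type*} [Group G]
    (h : sInf {H : Subgroup G | IsMaximalNilpotentSubgroup H} = ⊥) :
    ∃ H : Subgroup G, IsMaximalNilpotentSubgroup H := by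
  by_contra! hne
  have top_eq_bot : (⊤ : Subgroup G) = ⊥ := by
    have empty : {H : Subgroup G | IsMaximalNilpotentSubgroup H} = ∅ :=
      Set.eq_empty_of_forall_notMem hne
    rwa [empty, sInf_empty] at h
  exact hne ⊥ ⟨inferInstance, fun K _ _ => eq_bot_iff.2 (top_eq_bot ▸ le_top)⟩

/-- If the intersection of all maximal nilpotent subgroups of `G₁` and of `G₂` is trivial,
then the same holds for the direct product `G₁ × G₂`. -/
theorem stmt_9 (G₁ G₂ : Type*) [Group G₁] [Group G₂]
    (h₁ : sInf {H : Subgroup G₁ | IsMaximalNilpotentSubgroup H} = ⊥)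
    (h₂ : sInf {H : Subgroup G₂ | IsMaximalNilpotentSubgroup H} = ⊥) :
    sInf {H : Subgroup (G₁ × G₂) | IsMaximalNilpotentSubgroup H} = ⊥ := by
  obtain ⟨K₁, hK₁⟩ := exists_isMaximalNilpotentSubgroup_of_sInf_eq_bot h₁
  obtain ⟨K₂, hK₂⟩ := exists_isMaximalNilpotentSubgroup_of_sInf_eq_bot h₂
  refine eq_bot_iff.2 fun x hx => ?_
  rw [Subgroup.mem_sInf] at hx
  have hx₁ : x.1 ∈ (⊥ : Subgroup G₁) :=
    h₁ ▸ Subgroup.mem_sInf.2 fun H hH => (Subgroup.mem_prod.1 (hx _ (hH.prod hK₂))).1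
  have hx₂ : x.2 ∈ (⊥ : Subgroup G₂) :=
    h₂ ▸ Subgroup.mem_sInf.2 fun H hH => (Subgroup.mem_prod.1 (hx _ (hK₁.prod hH))).2
  exact Prod.ext hx₁ hx₂
end

section
/- Let G₁ and G₂ be Hopfian groups and let φ : G₁ × G₂ → G₁ × G₂ be a surjective group homomorphism such that φ maps the subgroup G₁ × {1} into G₁ × {1} and maps the subgroup {1} × G₂ into {1} × G₂. Then φ is injective, hence an automorphism of G₁ × G₂. -/
/-- A group is Hopfian if every surjective endomorphism is injective. -/
def IsHopfianGroup (G : Type*) [Group G] : Prop :=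
  ∀ φ : G →* G, Function.Surjective φ → Function.Injective φ

/-- If `G₁, G₂` are Hopfian and a surjective endomorphism `φ` of `G₁ × G₂` maps
`G₁ × {1}` into `G₁ × {1}` and `{1} × G₂` into `{1} × G₂`, then `φ` is injective. -/
theorem stmt_10 (G₁ G₂ : Type*) [Group G₁] [Group G₂]
    (h₁ : IsHopfianGroup G₁) (h₂ : IsHopfianGroup G₂)
    (φ : G₁ × G₂ →* G₁ × G₂) (hsurj : Function.Surjective φ)
    (hfac₁ : ((⊤ : Subgroup G₁).prod (⊥ : Subgroup G₂)).map φ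
      ≤ (⊤ : Subgroup G₁).prod (⊥ : Subgroup G₂))
    (hfac₂ : ((⊥ : Subgroup G₁).prod (⊤ : Subgroup G₂)).map φ
      ≤ (⊥ : Subgroup G₁).prod (⊤ : Subgroup G₂)) :
    Function.Injective φ := by
  have hφ : φ = (((MonoidHom.fst G₁ G₂).comp φ).comp (MonoidHom.inl G₁ G₂)).prodMap
      (((MonoidHom.snd G₁ G₂).comp φ).comp (MonoidHom.inr G₁ G₂)) := by
    apply MonoidHom.ext
    rintro ⟨a, b⟩
    have ha : (φ (a, 1)).2 = 1 := by
      simpa [Subgroup.mem_prod] using hfac₁ (Subgroup.mem_map_of_mem φ (x := (a, 1))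
        (by simp [Subgroup.mem_prod]))
    have hb : (φ (1, b)).1 = 1 := by
      simpa [Subgroup.mem_prod] using hfac₂ (Subgroup.mem_map_of_mem φ (x := (1, b))
        (by simp [Subgroup.mem_prod]))
    have hab : φ (a, b) = φ (a, 1) * φ (1, b) := by simp [← map_mul]
    rw [hab]
    ext <;> simp [ha, hb]
  rw [hφ, MonoidHom.coe_prodMap] at hsurj ⊢
  obtain ⟨hf, hg⟩ := Prod.map_surjective.mp hsurj
  exact (h₁ _ hf).prodMap (h₂ _ hg)
end
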